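/- (Homogeneous Sobolev embedding) Let d ≥ 1, s, s₁ ∈ ℝ with s ≤ s₁ and s > -d, and 1 < r₁ ≤ r < ∞ with s - d/r = s₁ - d/r₁. Then there is a constant C > 0, independent of f, such that for every f ∈ 𝒮(ℝ^d): ‖f‖_{Ẇ^{s,r}} ≤ C ‖f‖_{Ẇ^{s₁,r₁}}. -/

import Mathlib

open MeasureTheory Complex Filter
open scoped ENNReal RealInnerProductSpace

noncomputable section

/-- `d`-dimensional Euclidean space. -/
abbrev Ed (d : ℕ) := EuclideanSpace ℝ (Fin d)

/-- Fourier transform: `f̂(ξ) = ∫ e^{-i x·ξ} f(x) dx`. -/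
def FT (d : ℕ) (f : Ed d → ℂ) (ξ : Ed d) : ℂ :=
  ∫ x, Complex.exp (-Complex.I * (⟪x, ξ⟫ : ℝ)) * f x

/-- Inverse Fourier transform: `(F⁻¹ g)(x) = (2π)^{-d} ∫ e^{i x·ξ} g(ξ) dξ`. -/
def FTinv (d : ℕ) (g : Ed d → ℂ) (x : Ed d) : ℂ :=
  (((2 * Real.pi) ^ d : ℝ) : ℂ)⁻¹ * ∫ ξ, Complex.exp (Complex.I * (⟪x, ξ⟫ : ℝ)) * g ξ

/-- Bessel-type fractional differentiation `⟨D⟩^s f = F⁻¹((1+|ξ|²)^{s/2} f̂(ξ))`. -/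
def besselD (d : ℕ) (s : ℝ) (f : Ed d → ℂ) : Ed d → ℂ :=
  FTinv d fun ξ => (((1 + ‖ξ‖ ^ 2) ^ (s / 2) : ℝ) : ℂ) * FT d f ξ

/-- Riesz-type fractional differentiation `|D|^s f = F⁻¹(|ξ|^s f̂(ξ))`. -/
def rieszD (d : ℕ) (s : ℝ) (f : Ed d → ℂ) : Ed d → ℂ :=
  FTinv d fun ξ => ((‖ξ‖ ^ s : ℝ) : ℂ) * FT d f ξ

/-- Homogeneous Sobolev seminorm `‖f‖_{Ẇ^{s,r}} = ‖|D|^s f‖_{L^r}`. -/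
def sobNorm (d : ℕ) (s : ℝ) (r : ℝ≥0∞) (f : Ed d → ℂ) : ℝ≥0∞ :=
  eLpNorm (rieszD d s f) r volume

/-- The time integral `∫_S t^{a-1} (K_t g)(x) dt` attached to a family of kernels `K_t`. -/
def kernelPotential {X : Type*} [MeasurableSpace X] (μ : Measure X) (K : ℝ → X → X → ℝ≥0∞)
    (a : ℝ) (S : Set ℝ) (g : X → ℝ≥0∞) (x : X) : ℝ≥0∞ :=
  ∫⁻ t in S, ENNReal.ofReal (t ^ (a - 1)) * ∫⁻ y, K t x y * g y ∂μ

lemma lintegral_Ioc_rpow_sub_one {a τ : ℝ} (ha : 0 < a) (hτ : 0 ≤ τ) :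
    ∫⁻ t in Set.Ioc 0 τ, ENNReal.ofReal (t ^ (a - 1)) = ENNReal.ofReal (τ ^ a / a) := by
  have hint : IntegrableOn (fun t : ℝ => t ^ (a - 1)) (Set.Ioc 0 τ) :=
    (intervalIntegrable_iff_integrableOn_Ioc_of_le hτ).1
      (intervalIntegral.intervalIntegrable_rpow' (by linarith))
  rw [← ofReal_integral_eq_lintegral_ofReal hint, ← intervalIntegral.integral_of_le hτ,
    integral_rpow (Or.inl (by linarith))]
  · simp [Real.zero_rpow ha.ne']
  · filter_upwards [ae_restrict_mem measurableSet_Ioc] with t ht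
    exact Real.rpow_nonneg ht.1.le _

lemma lintegral_Ioi_rpow_neg_sub_one {b τ : ℝ} (hb : 0 < b) (hτ : 0 < τ) :
    ∫⁻ t in Set.Ioi τ, ENNReal.ofReal (t ^ (-b - 1)) = ENNReal.ofReal (τ ^ (-b) / b) := by
  rw [← ofReal_integral_eq_lintegral_ofReal
    (integrableOn_Ioi_rpow_of_lt (by linarith) hτ), integral_Ioi_rpow_of_lt (by linarith) hτ]
  · congr 1
    rw [sub_add_cancel, neg_div_neg_eq]
  · filter_upwards [ae_restrict_mem measurableSet_Ioi] with t ht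
    exact Real.rpow_nonneg (hτ.le.trans (le_of_lt ht)) _

/-- Hölder's inequality for a sub-Markov kernel bounded by `c`. -/
lemma lintegral_kernel_mul_le {X : Type*} [MeasurableSpace X] (μ : Measure X)
    {k g : X → ℝ≥0∞} (hk : Measurable k) (hg : Measurable g) {p : ℝ} (hp : 1 < p) {c : ℝ≥0∞}
    (h1 : ∫⁻ y, k y ∂μ ≤ 1) (hc : ∀ y, k y ≤ c) :
    ∫⁻ y, k y * g y ∂μ ≤ c ^ (1 / p) * (∫⁻ y, g y ^ p ∂μ) ^ (1 / p) := by
  have hpq : (Real.conjExponent p).HolderConjugate p :=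
    (Real.HolderConjugate.conjExponent hp).symm
  set q := Real.conjExponent p with hq
  have hp0 : 0 < p := by linarith
  have hq0 : 0 < q := hpq.pos
  have hsum : 1 / q + 1 / p = 1 := by
    have := hpq.inv_add_inv_eq_one
    simpa [one_div] using this
  have key := ENNReal.lintegral_mul_le_Lp_mul_Lq μ hpq
    (f := fun y => k y ^ (1 / q)) (g := fun y => k y ^ (1 / p) * g y)
    (hk.pow_const _).aemeasurable ((hk.pow_const _).mul hg).aemeasurable
  calc ∫⁻ y, k y * g y ∂μ
      = ∫⁻ y, ((fun y => k y ^ (1 / q)) * fun y => k y ^ (1 / p) * g y) y ∂μ := by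
        refine lintegral_congr fun y => ?_
        simp only [Pi.mul_apply]
        rw [← mul_assoc, ← ENNReal.rpow_add_of_nonneg _ _ (by positivity) (by positivity), hsum,
          ENNReal.rpow_one]
    _ ≤ (∫⁻ y, (k y ^ (1 / q)) ^ q ∂μ) ^ (1 / q) *
        (∫⁻ y, (k y ^ (1 / p) * g y) ^ p ∂μ) ^ (1 / p) := key
    _ ≤ 1 * (c * ∫⁻ y, g y ^ p ∂μ) ^ (1 / p) := by
        gcongr
        · simp only [← ENNReal.rpow_mul, one_div_mul_cancel hq0.ne', ENNReal.rpow_one]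
          exact (ENNReal.rpow_le_rpow h1 (by positivity)).trans_eq (ENNReal.one_rpow _)
        · rw [← lintegral_const_mul _ (hg.pow_const _)]
          refine lintegral_mono fun y => ?_
          rw [ENNReal.mul_rpow_of_nonneg _ _ hp0.le, ← ENNReal.rpow_mul,
            one_div_mul_cancel hp0.ne', ENNReal.rpow_one]
          exact mul_le_mul_left (hc y) _
    _ = c ^ (1 / p) * (∫⁻ y, g y ^ p ∂μ) ^ (1 / p) := by
        rw [one_mul, ENNReal.mul_rpow_of_nonneg _ _ (by positivity)]

section KernelPotential

variable {X : Type*} [MeasurableSpace X] {μ : Measure X} {K : ℝ → X → X → ℝ≥0∞}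

lemma kernelPotential_Ioc_le (h1 : ∀ t > 0, ∀ x, ∫⁻ y, K t x y ∂μ ≤ 1)
    (hK : Measurable fun z : ℝ × X × X => K z.1 z.2.1 z.2.2)
    {a τ : ℝ} (ha : 0 < a) (hτ : 0 ≤ τ) {g : X → ℝ≥0∞} {c : ℝ≥0∞} (hg : ∀ y, g y ≤ c) (x : X) :
    kernelPotential μ K a (Set.Ioc 0 τ) g x ≤ ENNReal.ofReal (τ ^ a / a) * c := by
  rw [← lintegral_Ioc_rpow_sub_one ha hτ, ← lintegral_mul_const _ (by fun_prop)]
  refine setLIntegral_mono' measurableSet_Ioc fun t ht => ?_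
  gcongr
  calc ∫⁻ y, K t x y * g y ∂μ ≤ ∫⁻ y, K t x y * c ∂μ := by gcongr; exact hg _
    _ = (∫⁻ y, K t x y ∂μ) * c := lintegral_mul_const _
        (hK.comp (by fun_prop : Measurable fun y : X => (t, x, y)))
    _ ≤ 1 * c := by gcongr; exact h1 t ht.1 x
    _ = c := one_mul c

lemma kernelPotential_Ioi_le (h1 : ∀ t > 0, ∀ x, ∫⁻ y, K t x y ∂μ ≤ 1)
    (hK : Measurable fun z : ℝ × X × X => K z.1 z.2.1 z.2.2)
    {B m : ℝ} (hB : 0 < B) (h3 : ∀ t > 0, ∀ x y, K t x y ≤ ENNReal.ofReal (B * t ^ (-m)))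
    {a b p τ : ℝ} (hp : 1 < p) (hb : 0 < b) (hab : m / p = a + b) (hτ : 0 < τ)
    {g : X → ℝ≥0∞} (hg : Measurable g) (hN : ∫⁻ y, g y ^ p ∂μ ≤ 1) (x : X) :
    kernelPotential μ K a (Set.Ioi τ) g x ≤ ENNReal.ofReal (B ^ (1 / p) * (τ ^ (-b) / b)) := by
  have hp0 : 0 < p := by linarith
  rw [ENNReal.ofReal_mul (by positivity), ← lintegral_Ioi_rpow_neg_sub_one hb hτ,
    ← lintegral_const_mul _ (by fun_prop)]
  refine setLIntegral_mono' measurableSet_Ioi fun t ht => ?_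
  have ht0 : 0 < t := hτ.trans ht
  have hbd := lintegral_kernel_mul_le μ
    (hK.comp (by fun_prop : Measurable fun y : X => (t, x, y))) hg hp (h1 t ht0 x) (h3 t ht0 x)
  calc ENNReal.ofReal (t ^ (a - 1)) * ∫⁻ y, K t x y * g y ∂μ
      ≤ ENNReal.ofReal (t ^ (a - 1)) * (ENNReal.ofReal (B * t ^ (-m)) ^ (1 / p) * 1) := by
        gcongr
        refine hbd.trans ?_
        gcongr
        exact (ENNReal.rpow_le_rpow hN (by positivity)).trans_eq (ENNReal.one_rpow _)
    _ = ENNReal.ofReal (B ^ (1 / p)) * ENNReal.ofReal (t ^ (-b - 1)) := by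
        rw [mul_one, ENNReal.ofReal_rpow_of_nonneg (by positivity) (by positivity),
          ← ENNReal.ofReal_mul (by positivity), ← ENNReal.ofReal_mul (by positivity),
          Real.mul_rpow hB.le (by positivity), ← Real.rpow_mul ht0.le, mul_left_comm,
          ← Real.rpow_add ht0]
        congr 3
        have : -m * (1 / p) = -(m / p) := by ring
        rw [this, hab]; ring

variable [SFinite μ]

lemma measurable_lintegral_kernel_mul
    (hK : Measurable fun z : ℝ × X × X => K z.1 z.2.1 z.2.2) {g : X → ℝ≥0∞} (hg : Measurable g) :
    Measurable fun z : ℝ × X => ∫⁻ y, K z.1 z.2 y * g y ∂μ := by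
  refine Measurable.lintegral_prod_right (f := fun (z : ℝ × X) y => K z.1 z.2 y * g y) ?_
  refine Measurable.mul ?_ (hg.comp measurable_snd)
  exact hK.comp (by fun_prop : Measurable fun w : (ℝ × X) × X => (w.1.1, w.1.2, w.2))

lemma measurable_kernelPotential
    (hK : Measurable fun z : ℝ × X × X => K z.1 z.2.1 z.2.2) {g : X → ℝ≥0∞} (hg : Measurable g)
    (a : ℝ) (S : Set ℝ) : Measurable (kernelPotential μ K a S g) := by
  have := measurable_lintegral_kernel_mul (μ := μ) hK hg
  refine Measurable.lintegral_prod_right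
    (f := fun x t => ENNReal.ofReal (t ^ (a - 1)) * ∫⁻ y, K t x y * g y ∂μ) ?_
  refine Measurable.mul (by fun_prop) ?_
  exact this.comp (by fun_prop : Measurable fun w : X × ℝ => (w.2, w.1))

lemma lintegral_kernelPotential_Ioc_le (h2 : ∀ t > 0, ∀ y, ∫⁻ x, K t x y ∂μ ≤ 1)
    (hK : Measurable fun z : ℝ × X × X => K z.1 z.2.1 z.2.2)
    {a τ : ℝ} (ha : 0 < a) (hτ : 0 ≤ τ) {g : X → ℝ≥0∞} (hg : Measurable g) :
    ∫⁻ x, kernelPotential μ K a (Set.Ioc 0 τ) g x ∂μ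
      ≤ ENNReal.ofReal (τ ^ a / a) * ∫⁻ y, g y ∂μ := by
  have hm := measurable_lintegral_kernel_mul (μ := μ) hK hg
  unfold kernelPotential
  rw [lintegral_lintegral_swap, ← lintegral_Ioc_rpow_sub_one ha hτ,
    ← lintegral_mul_const _ (by fun_prop)]
  · refine setLIntegral_mono' measurableSet_Ioc fun t ht => ?_
    have hmt : Measurable fun x => ∫⁻ y, K t x y * g y ∂μ :=
      hm.comp (by fun_prop : Measurable fun x : X => (t, x))
    rw [lintegral_const_mul _ hmt]
    refine mul_le_mul_right ?_ _
    rw [lintegral_lintegral_swap]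
    · refine lintegral_mono fun y => ?_
      have hKy : Measurable fun x => K t x y :=
        hK.comp (by fun_prop : Measurable fun x : X => (t, x, y))
      rw [lintegral_mul_const _ hKy]
      exact (mul_le_mul_left (h2 t ht.1 y) _).trans_eq (one_mul _)
    · refine Measurable.aemeasurable (Measurable.mul ?_ (hg.comp measurable_snd))
      exact hK.comp (by fun_prop : Measurable fun w : X × X => (t, w.1, w.2))
  · refine Measurable.aemeasurable (Measurable.mul (by fun_prop) ?_)
    exact hm.comp (by fun_prop : Measurable fun w : X × ℝ => (w.2, w.1))

/-- Level set estimate: `ℓ μ{λ < Tg} ≤ ∫_{g > ℓ} g` with `ℓ = k λ^{1 + a/b}`. -/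
lemma meas_kernelPotential_le (h1 : ∀ t > 0, ∀ x, ∫⁻ y, K t x y ∂μ ≤ 1)
    (h2 : ∀ t > 0, ∀ y, ∫⁻ x, K t x y ∂μ ≤ 1)
    (hK : Measurable fun z : ℝ × X × X => K z.1 z.2.1 z.2.2)
    {B m : ℝ} (hB : 0 < B) (h3 : ∀ t > 0, ∀ x y, K t x y ≤ ENNReal.ofReal (B * t ^ (-m)))
    {a b p : ℝ} (hp : 1 < p) (ha : 0 < a) (hb : 0 < b) (hab : m / p = a + b) :
    ∃ k : ℝ, 0 < k ∧ ∀ g : X → ℝ≥0∞, Measurable g → ∫⁻ y, g y ^ p ∂μ ≤ 1 →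
      ∀ l : ℝ, 0 < l →
        ENNReal.ofReal (k * l ^ (1 + a / b)) *
            μ {x | ENNReal.ofReal l < kernelPotential μ K a (Set.Ioi 0) g x} ≤
          ∫⁻ y in {y | ENNReal.ofReal (k * l ^ (1 + a / b)) < g y}, g y ∂μ := by
  set c : ℝ := b / (3 * B ^ (1 / p)) with hc
  have hc0 : 0 < c := by positivity
  refine ⟨a * c ^ (a / b) / 3, by positivity, fun g hg hN l hl => ?_⟩
  set τ : ℝ := (c * l) ^ (-(1 / b)) with hτdef
  have hτ : 0 < τ := by positivity
  have hτa : τ ^ (-a) = c ^ (a / b) * l ^ (a / b) := by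
    rw [hτdef, ← Real.rpow_mul (by positivity), ← Real.mul_rpow hc0.le hl.le]
    congr 1; ring
  have hτb : τ ^ (-b) = c * l := by
    rw [hτdef, ← Real.rpow_mul (by positivity)]
    rw [show -(1 / b) * -b = 1 by field_simp, Real.rpow_one]
  have hlev : a * c ^ (a / b) / 3 * l ^ (1 + a / b) = a * τ ^ (-a) * (l / 3) := by
    rw [hτa, Real.rpow_add hl, Real.rpow_one]; ring
  rw [hlev]
  set v : ℝ := a * τ ^ (-a) * (l / 3) with hv
  have hinv : a * τ ^ (-a) * (τ ^ a / a) = 1 := by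
    rw [Real.rpow_neg hτ.le]; field_simp
  set A : Set X := {y | ENNReal.ofReal v < g y} with hA
  have hAm : MeasurableSet A := measurableSet_lt measurable_const hg
  have hsub : {x | ENNReal.ofReal l < kernelPotential μ K a (Set.Ioi 0) g x} ⊆
      {x | ENNReal.ofReal (l / 3) ≤ kernelPotential μ K a (Set.Ioc 0 τ) (A.indicator g) x} := by
    intro x hx
    simp only [Set.mem_ofPred_eq] at hx ⊢
    by_contra! hcon
    have hlow : kernelPotential μ K a (Set.Ioc 0 τ) (Aᶜ.indicator g) x ≤ ENNReal.ofReal (l / 3) := by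
      refine (kernelPotential_Ioc_le h1 hK ha hτ.le (c := ENNReal.ofReal v) (fun y => ?_) x).trans ?_
      · by_cases hy : y ∈ Aᶜ
        · rw [Set.indicator_of_mem hy]; simpa [hA] using hy
        · rw [Set.indicator_of_notMem hy]; exact zero_le
      · rw [← ENNReal.ofReal_mul (by positivity)]
        refine ENNReal.ofReal_le_ofReal (le_of_eq ?_)
        rw [hv, ← mul_assoc, mul_comm (τ ^ a / a), hinv, one_mul]
    have hhigh : kernelPotential μ K a (Set.Ioi τ) g x ≤ ENNReal.ofReal (l / 3) := by
      refine (kernelPotential_Ioi_le h1 hK hB h3 hp hb hab hτ hg hN x).trans ?_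
      refine ENNReal.ofReal_le_ofReal (le_of_eq ?_)
      rw [hτb, hc]; field_simp
    have hdec : kernelPotential μ K a (Set.Ioi 0) g x =
        kernelPotential μ K a (Set.Ioc 0 τ) (A.indicator g) x +
        kernelPotential μ K a (Set.Ioc 0 τ) (Aᶜ.indicator g) x +
        kernelPotential μ K a (Set.Ioi τ) g x := by
      unfold kernelPotential
      rw [← Set.Ioc_union_Ioi_eq_Ioi hτ.le, lintegral_union measurableSet_Ioi
        (Set.Ioc_disjoint_Ioi le_rfl)]
      congr 1
      rw [← lintegral_add_left]
      · refine lintegral_congr fun t => ?_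
        rw [← mul_add, ← lintegral_add_left]
        · congr 1
          refine lintegral_congr fun y => ?_
          rw [← mul_add]
          congr 1
          exact (congrFun (Set.indicator_self_add_compl A g) y).symm
        · exact (hK.comp (by fun_prop : Measurable fun y : X => (t, x, y))).mul (hg.indicator hAm)
      · refine Measurable.mul (by fun_prop) ?_
        exact (measurable_lintegral_kernel_mul (μ := μ) hK (hg.indicator hAm)).comp
          (by fun_prop : Measurable fun t : ℝ => (t, x))
    have h3l : ENNReal.ofReal l =
        ENNReal.ofReal (l / 3) + ENNReal.ofReal (l / 3) + ENNReal.ofReal (l / 3) := by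
      rw [← ENNReal.ofReal_add (by positivity) (by positivity),
        ← ENNReal.ofReal_add (by positivity) (by positivity)]
      congr 1; ring
    rw [hdec, h3l] at hx
    exact absurd hx (not_lt.2 (add_le_add (add_le_add hcon.le hlow) hhigh))
  calc ENNReal.ofReal v * μ {x | ENNReal.ofReal l < kernelPotential μ K a (Set.Ioi 0) g x}
      ≤ ENNReal.ofReal (a * τ ^ (-a)) * (ENNReal.ofReal (l / 3) *
        μ {x | ENNReal.ofReal (l / 3) ≤
          kernelPotential μ K a (Set.Ioc 0 τ) (A.indicator g) x}) := by
        rw [hv, ENNReal.ofReal_mul (by positivity), mul_assoc]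
        gcongr
    _ ≤ ENNReal.ofReal (a * τ ^ (-a)) * (ENNReal.ofReal (τ ^ a / a) *
        ∫⁻ y, A.indicator g y ∂μ) := by
        refine mul_le_mul_right ?_ _
        exact (mul_meas_ge_le_lintegral
          (measurable_kernelPotential hK (hg.indicator hAm) a _) _).trans
          (lintegral_kernelPotential_Ioc_le h2 hK ha hτ.le (hg.indicator hAm))
    _ = ∫⁻ y in A, g y ∂μ := by
        rw [← mul_assoc, ← ENNReal.ofReal_mul (by positivity), hinv, ENNReal.ofReal_one, one_mul,
          lintegral_indicator hAm]

/-- Hardy–Littlewood–Sobolev inequality for kernel potentials, in normalized form. -/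
lemma lintegral_rpow_le_of_le_kernelPotential (h1 : ∀ t > 0, ∀ x, ∫⁻ y, K t x y ∂μ ≤ 1)
    (h2 : ∀ t > 0, ∀ y, ∫⁻ x, K t x y ∂μ ≤ 1)
    (hK : Measurable fun z : ℝ × X × X => K z.1 z.2.1 z.2.2)
    {B m : ℝ} (hB : 0 < B) (h3 : ∀ t > 0, ∀ x y, K t x y ≤ ENNReal.ofReal (B * t ^ (-m)))
    {a b p r : ℝ} (hp : 1 < p) (ha : 0 < a) (hb : 0 < b) (hab : m / p = a + b) (hr : r = m / b) :
    ∃ C : ℝ, 0 < C ∧ ∀ F g : X → ℝ, AEMeasurable F μ → Measurable g → (∀ x, 0 ≤ F x) →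
      (∀ x, 0 ≤ g x) → ∫⁻ y, ENNReal.ofReal (g y ^ p) ∂μ ≤ 1 →
      (∀ x, ENNReal.ofReal (F x) ≤
        kernelPotential μ K a (Set.Ioi 0) (fun y => ENNReal.ofReal (g y)) x) →
      ∫⁻ x, ENNReal.ofReal (F x ^ r) ∂μ ≤ ENNReal.ofReal C := by
  obtain ⟨k, hk, hlev⟩ := meas_kernelPotential_le h1 h2 hK hB h3 hp ha hb hab
  set e : ℝ := 1 + a / b with he
  have hp0 : 0 < p := by linarith
  have he0 : 0 < e := by positivity
  have hre : r = p * e := by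
    rw [hr, he]; field_simp; field_simp at hab; linarith
  have hr0 : 0 < r := by rw [hre]; positivity
  have hs : 0 < r - e := by rw [hre]; nlinarith
  refine ⟨r * (k⁻¹ ^ p / (r - e)), by positivity, fun F g hF hg hF0 hg0 hN hFg => ?_⟩
  have hN' : ∫⁻ y, ENNReal.ofReal (g y) ^ p ∂μ ≤ 1 := by
    simpa only [ENNReal.ofReal_rpow_of_nonneg (hg0 _) hp0.le] using hN
  rw [lintegral_rpow_eq_lintegral_meas_lt_mul μ (Eventually.of_forall hF0) hF hr0,
    ENNReal.ofReal_mul hr0.le]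
  gcongr
  have hgm : Measurable fun w : ℝ × X => ({w : ℝ × X | k * w.1 ^ e < g w.2}).indicator
      (fun w => ENNReal.ofReal (w.1 ^ (r - e - 1) / k) * ENNReal.ofReal (g w.2)) w := by
    refine Measurable.indicator (by fun_prop) (measurableSet_lt (by fun_prop) (by fun_prop))
  calc ∫⁻ l in Set.Ioi 0, μ {x | l < F x} * ENNReal.ofReal (l ^ (r - 1))
      ≤ ∫⁻ l in Set.Ioi 0, ∫⁻ y, ({w : ℝ × X | k * w.1 ^ e < g w.2}).indicator
          (fun w => ENNReal.ofReal (w.1 ^ (r - e - 1) / k) * ENNReal.ofReal (g w.2)) (l, y) ∂μ := by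
        refine setLIntegral_mono' measurableSet_Ioi fun l (hl : 0 < l) => ?_
        have hsub : {x | l < F x} ⊆ {x | ENNReal.ofReal l <
            kernelPotential μ K a (Set.Ioi 0) (fun y => ENNReal.ofReal (g y)) x} := by
          intro x (hx : l < F x)
          exact ((ENNReal.ofReal_lt_ofReal_iff (hl.trans hx)).2 hx).trans_le (hFg x)
        have hl' := hlev _ hg.ennreal_ofReal hN' l hl
        have hset : {y | ENNReal.ofReal (k * l ^ e) < ENNReal.ofReal (g y)} =
            {y | k * l ^ e < g y} := by
          ext y
          exact ENNReal.ofReal_lt_ofReal_iff_of_nonneg (by positivity)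
        have hms : MeasurableSet {y | k * l ^ e < g y} := measurableSet_lt measurable_const hg
        rw [hset] at hl'
        have hfac : l ^ (r - 1) = l ^ (r - e - 1) / k * (k * l ^ e) := by
          rw [show r - 1 = (r - e - 1) + e by ring, Real.rpow_add hl]
          field_simp
        calc μ {x | l < F x} * ENNReal.ofReal (l ^ (r - 1))
            = ENNReal.ofReal (l ^ (r - e - 1) / k) *
                (ENNReal.ofReal (k * l ^ e) * μ {x | l < F x}) := by
              rw [hfac, ENNReal.ofReal_mul (by positivity)]; ring
          _ ≤ ENNReal.ofReal (l ^ (r - e - 1) / k) *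
                ∫⁻ y in {y | k * l ^ e < g y}, ENNReal.ofReal (g y) ∂μ := by
              gcongr
              exact le_trans (by gcongr) hl'
          _ = _ := by
              rw [← lintegral_indicator hms,
                ← lintegral_const_mul _ (hg.ennreal_ofReal.indicator hms)]
              refine lintegral_congr fun y => ?_
              by_cases hy : k * l ^ e < g y <;> simp [Set.indicator, hy]
    _ = ∫⁻ y, (∫⁻ l in Set.Ioi (0 : ℝ), ({w : ℝ × X | k * w.1 ^ e < g w.2}).indicator
          (fun w => ENNReal.ofReal (w.1 ^ (r - e - 1) / k) * ENNReal.ofReal (g w.2)) (l, y)) ∂μ :=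
        lintegral_lintegral_swap hgm.aemeasurable
    _ ≤ ∫⁻ y, ENNReal.ofReal (k⁻¹ ^ p / (r - e)) * ENNReal.ofReal (g y ^ p) ∂μ := by
        refine lintegral_mono fun y => ?_
        have hT : 0 ≤ (g y / k) ^ (1 / e) := Real.rpow_nonneg (div_nonneg (hg0 y) hk.le) _
        calc ∫⁻ l in Set.Ioi (0 : ℝ), ({w : ℝ × X | k * w.1 ^ e < g w.2}).indicator
              (fun w => ENNReal.ofReal (w.1 ^ (r - e - 1) / k) * ENNReal.ofReal (g w.2)) (l, y)
            ≤ ∫⁻ l in Set.Ioi 0, (Set.Ioc 0 ((g y / k) ^ (1 / e))).indicator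
              (fun l => ENNReal.ofReal (l ^ (r - e - 1)) * ENNReal.ofReal (g y / k)) l := by
              refine setLIntegral_mono' measurableSet_Ioi fun l (hl : 0 < l) => ?_
              by_cases hy : k * l ^ e < g y
              · have hmem : l ∈ Set.Ioc 0 ((g y / k) ^ (1 / e)) := by
                  refine ⟨hl, ?_⟩
                  rw [one_div, Real.le_rpow_inv_iff_of_pos hl.le (div_nonneg (hg0 y) hk.le) he0,
                    le_div_iff₀ hk]
                  linarith
                rw [Set.indicator_of_mem hmem, Set.indicator_of_mem (by exact hy),
                  ← ENNReal.ofReal_mul (by positivity), ← ENNReal.ofReal_mul (by positivity)]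
                refine ENNReal.ofReal_le_ofReal (le_of_eq ?_)
                ring
              · rw [Set.indicator_of_notMem (by exact hy)]; exact zero_le
          _ ≤ ∫⁻ l in Set.Ioc 0 ((g y / k) ^ (1 / e)),
                ENNReal.ofReal (l ^ (r - e - 1)) * ENNReal.ofReal (g y / k) := by
              rw [← lintegral_indicator measurableSet_Ioc]
              exact setLIntegral_le_lintegral _ _
          _ = ENNReal.ofReal (k⁻¹ ^ p / (r - e)) * ENNReal.ofReal (g y ^ p) := by
              rw [lintegral_mul_const _ (by fun_prop), lintegral_Ioc_rpow_sub_one hs hT,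
                ← ENNReal.ofReal_mul (by positivity), ← ENNReal.ofReal_mul (by positivity),
                ← Real.rpow_mul (div_nonneg (hg0 y) hk.le)]
              congr 1
              have hexp : 1 / e * (r - e) = p - 1 := by rw [hre]; field_simp
              have hpow : (g y / k) ^ (p - 1) * (g y / k) = (g y / k) ^ p := by
                rcases (div_nonneg (hg0 y) hk.le).eq_or_lt with h | h
                · rw [← h, mul_zero, Real.zero_rpow hp0.ne']
                · nth_rewrite 2 [← Real.rpow_one (g y / k)]
                  rw [← Real.rpow_add h]; congr 1; ring
              rw [hexp, div_mul_eq_mul_div, hpow, div_eq_mul_inv (g y),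
                Real.mul_rpow (hg0 y) (by positivity)]
              ring
    _ ≤ ENNReal.ofReal (k⁻¹ ^ p / (r - e)) := by
        rw [lintegral_const_mul _ (by fun_prop)]
        exact (mul_le_mul_right hN _).trans_eq (mul_one _)

end KernelPotential

/-- The heat kernel `(4πt)^{-d/2} e^{-|x-y|²/(4t)}`. -/
def heatKernel (d : ℕ) (t : ℝ) (x y : Ed d) : ℝ :=
  (4 * Real.pi * t) ^ (-((d : ℝ) / 2)) * Real.exp (-(1 / (4 * t)) * ‖x - y‖ ^ 2)

lemma measurable_heatKernel (d : ℕ) :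
    Measurable fun z : ℝ × Ed d × Ed d => heatKernel d z.1 z.2.1 z.2.2 := by
  unfold heatKernel; fun_prop

lemma heatKernel_nonneg (d : ℕ) {t : ℝ} (ht : 0 < t) (x y : Ed d) : 0 ≤ heatKernel d t x y := by
  unfold heatKernel; positivity

lemma heatKernel_symm (d : ℕ) (t : ℝ) (x y : Ed d) : heatKernel d t x y = heatKernel d t y x := by
  unfold heatKernel; rw [norm_sub_rev]

lemma heatKernel_le (d : ℕ) {t : ℝ} (ht : 0 < t) (x y : Ed d) :
    heatKernel d t x y ≤ (4 * Real.pi) ^ (-((d : ℝ) / 2)) * t ^ (-((d : ℝ) / 2)) := by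
  unfold heatKernel
  rw [← Real.mul_rpow (by positivity) ht.le]
  refine mul_le_of_le_one_right (by positivity) (Real.exp_le_one_iff.2 ?_)
  rw [neg_mul]
  exact neg_nonpos.2 (by positivity)

/-- The Fourier transform of the heat kernel. -/
lemma integral_heatKernel_mul_cexp (d : ℕ) {t : ℝ} (ht : 0 < t) (x ξ : Ed d) :
    ∫ y, (heatKernel d t x y : ℂ) * cexp (I * (⟪y, ξ⟫ : ℝ)) =
      cexp (I * (⟪x, ξ⟫ : ℝ)) * (Real.exp (-(t * ‖ξ‖ ^ 2)) : ℂ) := by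
  have h4t : (0 : ℝ) < 4 * Real.pi * t := by positivity
  have hre : 0 < ((1 / (4 * t) : ℝ) : ℂ).re := by rw [ofReal_re]; positivity
  rw [← integral_add_left_eq_self _ x]
  have hstep : ∀ v : Ed d, (heatKernel d t x (x + v) : ℂ) * cexp (I * (⟪x + v, ξ⟫ : ℝ)) =
      (((4 * Real.pi * t) ^ (-((d : ℝ) / 2)) : ℝ) * cexp (I * (⟪x, ξ⟫ : ℝ))) *
        cexp (-((1 / (4 * t) : ℝ) : ℂ) * (‖v‖ : ℂ) ^ 2 + I * (⟪ξ, v⟫ : ℝ)) := by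
    intro v
    rw [heatKernel, sub_add_cancel_left, norm_neg, inner_add_left, real_inner_comm ξ v, ofReal_mul,
      ofReal_exp, mul_assoc (ofReal _), mul_assoc (ofReal _), ← Complex.exp_add, ← Complex.exp_add]
    congr 2
    push_cast
    ring
  simp_rw [hstep]
  rw [integral_const_mul, GaussianFourier.integral_cexp_neg_mul_sq_norm_add hre]
  have hpow : ((Real.pi : ℂ) / ((1 / (4 * t) : ℝ) : ℂ)) ^ (Module.finrank ℝ (Ed d) / 2 : ℂ) =
      (((4 * Real.pi * t) ^ ((d : ℝ) / 2) : ℝ) : ℂ) := by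
    rw [ofReal_cpow h4t.le, finrank_euclideanSpace, Fintype.card_fin]
    push_cast
    congr 1
    field_simp
  have hexp : I ^ 2 * (‖ξ‖ : ℂ) ^ 2 / (4 * ((1 / (4 * t) : ℝ) : ℂ)) =
      ((-(t * ‖ξ‖ ^ 2) : ℝ) : ℂ) := by
    have : (t : ℂ) ≠ 0 := by exact_mod_cast ht.ne'
    rw [I_sq]; push_cast; field_simp
  have hone : (((4 * Real.pi * t) ^ (-((d : ℝ) / 2)) : ℝ) : ℂ) *
      (((4 * Real.pi * t) ^ ((d : ℝ) / 2) : ℝ) : ℂ) = 1 := by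
    rw [← ofReal_mul, ← Real.rpow_add h4t, neg_add_cancel, Real.rpow_zero, ofReal_one]
  rw [hpow, hexp, ofReal_exp]
  linear_combination (cexp (I * (⟪x, ξ⟫ : ℝ)) * cexp ((-(t * ‖ξ‖ ^ 2) : ℝ) : ℂ)) * hone

lemma integrable_heatKernel (d : ℕ) {t : ℝ} (ht : 0 < t) (x : Ed d) :
    Integrable fun y => heatKernel d t x y := by
  have hre : 0 < ((1 / (4 * t) : ℝ) : ℂ).re := by rw [ofReal_re]; positivity
  have h := ((GaussianFourier.integrable_cexp_neg_mul_sq_norm_add hre 0 (0 : Ed d)).norm.const_mul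
    ((4 * Real.pi * t) ^ (-((d : ℝ) / 2)))).comp_sub_left x
  refine h.congr (Eventually.of_forall fun y => ?_)
  simp only [heatKernel, zero_mul, add_zero, Complex.norm_exp]
  congr 2
  norm_cast

lemma integral_heatKernel (d : ℕ) {t : ℝ} (ht : 0 < t) (x : Ed d) :
    ∫ y, heatKernel d t x y = 1 := by
  have h := integral_heatKernel_mul_cexp d ht x 0
  simp only [inner_zero_right, ofReal_zero, mul_zero, Complex.exp_zero, mul_one, norm_zero,
    ne_eq, OfNat.ofNat_ne_zero, not_false_eq_true, zero_pow, neg_zero, Real.exp_zero,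
    ofReal_one] at h
  exact_mod_cast h

lemma lintegral_heatKernel (d : ℕ) {t : ℝ} (ht : 0 < t) (x : Ed d) :
    ∫⁻ y, ENNReal.ofReal (heatKernel d t x y) = 1 := by
  rw [← ofReal_integral_eq_lintegral_ofReal (integrable_heatKernel d ht x)
    (Eventually.of_forall fun y => heatKernel_nonneg d ht x y), integral_heatKernel d ht,
    ENNReal.ofReal_one]

lemma norm_cexp_I_mul_inner {d : ℕ} (x ξ : Ed d) : ‖cexp (I * (⟪x, ξ⟫ : ℝ))‖ = 1 :=
  norm_exp_I_mul_ofReal _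

/-- The heat semigroup acts by convolution with the heat kernel. -/
lemma FTinv_exp_mul (d : ℕ) {t : ℝ} (ht : 0 < t) {h : Ed d → ℂ} (hh : Integrable h) (x : Ed d) :
    FTinv d (fun ξ => (Real.exp (-(t * ‖ξ‖ ^ 2)) : ℂ) * h ξ) x =
      ∫ y, (heatKernel d t x y : ℂ) * FTinv d h y := by
  have hint : Integrable (Function.uncurry fun (y ξ : Ed d) =>
      cexp (I * (⟪y, ξ⟫ : ℝ)) * ((heatKernel d t x y : ℂ) * h ξ)) (volume.prod volume) := by
    refine Integrable.bdd_mul (c := 1)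
      (Integrable.mul_prod (integrable_heatKernel d ht x).ofReal hh) ?_ ?_
    · exact Continuous.aestronglyMeasurable (by fun_prop)
    · exact Eventually.of_forall fun z => (norm_cexp_I_mul_inner _ _).le
  unfold FTinv
  have h1 : ∀ y : Ed d, (heatKernel d t x y : ℂ) * ((((2 * Real.pi) ^ d : ℝ) : ℂ)⁻¹ *
      ∫ ξ, cexp (I * (⟪y, ξ⟫ : ℝ)) * h ξ) = (((2 * Real.pi) ^ d : ℝ) : ℂ)⁻¹ *
      ∫ ξ, cexp (I * (⟪y, ξ⟫ : ℝ)) * ((heatKernel d t x y : ℂ) * h ξ) := by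
    intro y
    rw [mul_left_comm, ← integral_const_mul]
    congr 2
    ext ξ; ring
  simp_rw [h1]
  rw [integral_const_mul, integral_integral_swap hint]
  congr 2
  ext ξ
  have h2 : ∀ y : Ed d, cexp (I * (⟪y, ξ⟫ : ℝ)) * ((heatKernel d t x y : ℂ) * h ξ) =
      ((heatKernel d t x y : ℂ) * cexp (I * (⟪y, ξ⟫ : ℝ))) * h ξ := fun y => by ring
  simp_rw [h2]
  rw [integral_mul_const, integral_heatKernel_mul_cexp d ht]
  ring

lemma integrableOn_rpow_mul_exp_neg_mul {a r : ℝ} (ha : 0 < a) (hr : 0 < r) :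
    IntegrableOn (fun t : ℝ => t ^ (a - 1) * Real.exp (-(r * t))) (Set.Ioi 0) := by
  by_contra hcon
  have h := Real.integral_rpow_mul_exp_neg_mul_Ioi ha hr
  rw [integral_undef hcon] at h
  have : 0 < (1 / r) ^ a * Real.Gamma a := mul_pos (by positivity) (Real.Gamma_pos_of_pos ha)
  linarith

/-- Subordination of `|D|^{-2a}` to the heat semigroup. -/
lemma enorm_FTinv_rpow_mul_le (d : ℕ) (hd : 1 ≤ d) {a : ℝ} (ha : 0 < a) {h : Ed d → ℂ}
    (hm : Measurable h) (hi : Integrable fun ξ : Ed d => ((‖ξ‖ ^ (-(2 * a)) : ℝ) : ℂ) * h ξ)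
    (x : Ed d) :
    ENNReal.ofReal (Real.Gamma a) *
        ‖FTinv d (fun ξ => ((‖ξ‖ ^ (-(2 * a)) : ℝ) : ℂ) * h ξ) x‖ₑ ≤
      ∫⁻ t in Set.Ioi 0, ENNReal.ofReal (t ^ (a - 1)) *
        ‖FTinv d (fun ξ => (Real.exp (-(t * ‖ξ‖ ^ 2)) : ℂ) * h ξ) x‖ₑ := by
  have hGa := Real.Gamma_pos_of_pos ha
  have : Nonempty (Fin d) := ⟨⟨0, hd⟩⟩
  have hne : ∀ᵐ ξ : Ed d, ξ ≠ 0 := by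
    simp [ae_iff]
  have hgam : ∀ ξ : Ed d, ξ ≠ 0 → ∫ t in Set.Ioi (0 : ℝ), t ^ (a - 1) *
      Real.exp (-(t * ‖ξ‖ ^ 2)) = ‖ξ‖ ^ (-(2 * a)) * Real.Gamma a := by
    intro ξ hξ
    have hn : 0 < ‖ξ‖ := norm_pos_iff.2 hξ
    have := Real.integral_rpow_mul_exp_neg_mul_Ioi ha (r := ‖ξ‖ ^ 2) (by positivity)
    simp_rw [mul_comm _ (‖ξ‖ ^ 2)]
    rw [this, Real.rpow_neg hn.le, Real.rpow_mul hn.le, one_div, Real.inv_rpow (by positivity)]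
    norm_num
  set G : Ed d → ℝ → ℂ := fun ξ t => ((t ^ (a - 1) * Real.exp (-(t * ‖ξ‖ ^ 2)) : ℝ) : ℂ) *
    (cexp (I * (⟪x, ξ⟫ : ℝ)) * h ξ) with hG
  have hGm : Measurable (Function.uncurry G) := by
    have : Measurable fun z : Ed d × ℝ => h z.1 := hm.comp measurable_fst
    simp only [hG, Function.uncurry_def]
    fun_prop
  have hGi : Integrable (Function.uncurry G) (volume.prod (volume.restrict (Set.Ioi 0))) := by
    rw [integrable_prod_iff hGm.aestronglyMeasurable]
    constructor
    · filter_upwards [hne] with ξ hξ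
      have hn : 0 < ‖ξ‖ := norm_pos_iff.2 hξ
      have := integrableOn_rpow_mul_exp_neg_mul ha (r := ‖ξ‖ ^ 2) (by positivity)
      simp_rw [mul_comm (‖ξ‖ ^ 2)] at this
      exact (Integrable.ofReal (𝕜 := ℂ) this).mul_const (cexp (I * (⟪x, ξ⟫ : ℝ)) * h ξ)
    · refine (hi.norm.const_mul (Real.Gamma a)).congr ?_
      filter_upwards [hne] with ξ hξ
      have : ∀ t ∈ Set.Ioi (0 : ℝ), ‖Function.uncurry G (ξ, t)‖ =
          t ^ (a - 1) * Real.exp (-(t * ‖ξ‖ ^ 2)) * ‖h ξ‖ := by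
        intro t (ht : 0 < t)
        simp only [hG, Function.uncurry_apply_pair, norm_mul, norm_cexp_I_mul_inner, one_mul,
          norm_real]
        rw [Real.norm_of_nonneg (by positivity), Real.norm_of_nonneg (by positivity)]
      rw [setIntegral_congr_fun measurableSet_Ioi this, integral_mul_const, hgam ξ hξ, norm_mul,
        norm_real, Real.norm_of_nonneg (by positivity)]
      ring
  have hid : (Real.Gamma a : ℂ) * FTinv d (fun ξ => ((‖ξ‖ ^ (-(2 * a)) : ℝ) : ℂ) * h ξ) x =
      ∫ t in Set.Ioi (0 : ℝ), ((t ^ (a - 1) : ℝ) : ℂ) *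
        FTinv d (fun ξ => (Real.exp (-(t * ‖ξ‖ ^ 2)) : ℂ) * h ξ) x := by
    have h1 : (Real.Gamma a : ℂ) * ∫ ξ, cexp (I * (⟪x, ξ⟫ : ℝ)) *
        (((‖ξ‖ ^ (-(2 * a)) : ℝ) : ℂ) * h ξ) = ∫ ξ, ∫ t in Set.Ioi (0 : ℝ), G ξ t := by
      rw [← integral_const_mul]
      refine integral_congr_ae ?_
      filter_upwards [hne] with ξ hξ
      simp only [hG]
      rw [integral_mul_const, integral_complex_ofReal, hgam ξ hξ]
      push_cast
      ring
    unfold FTinv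
    rw [mul_left_comm, h1, integral_integral_swap hGi, ← integral_const_mul]
    refine integral_congr_ae (Eventually.of_forall fun t => ?_)
    simp only
    rw [mul_left_comm]
    congr 1
    rw [← integral_const_mul]
    congr 1
    ext ξ
    simp only [hG]
    push_cast
    ring
  calc ENNReal.ofReal (Real.Gamma a) *
        ‖FTinv d (fun ξ => ((‖ξ‖ ^ (-(2 * a)) : ℝ) : ℂ) * h ξ) x‖ₑ
      = ‖(Real.Gamma a : ℂ) * FTinv d (fun ξ => ((‖ξ‖ ^ (-(2 * a)) : ℝ) : ℂ) * h ξ) x‖ₑ := by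
        rw [enorm_mul, ← ofReal_norm (Real.Gamma a : ℂ), norm_real,
          Real.norm_of_nonneg hGa.le]
    _ ≤ _ := by
        rw [hid]
        refine (enorm_integral_le_lintegral_enorm _).trans_eq ?_
        refine setLIntegral_congr_fun measurableSet_Ioi fun t (ht : 0 < t) => ?_
        simp only [enorm_mul]
        rw [← ofReal_norm ((t ^ (a - 1) : ℝ) : ℂ), norm_real,
          Real.norm_of_nonneg (by positivity)]

lemma measurable_FT (d : ℕ) {f : Ed d → ℂ} (hf : Measurable f) : Measurable (FT d f) := by
  refine (StronglyMeasurable.integral_prod_right (ν := volume)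
    (f := fun (ξ : Ed d) (x : Ed d) => cexp (-I * (⟪x, ξ⟫ : ℝ)) * f x) ?_).measurable
  refine Measurable.stronglyMeasurable (Measurable.mul (by fun_prop) (hf.comp measurable_snd))

lemma measurable_FTinv (d : ℕ) {h : Ed d → ℂ} (hh : Measurable h) : Measurable (FTinv d h) := by
  refine Measurable.const_mul (StronglyMeasurable.integral_prod_right (ν := volume)
    (f := fun (x : Ed d) (ξ : Ed d) => cexp (I * (⟪x, ξ⟫ : ℝ)) * h ξ) ?_).measurable _
  refine Measurable.stronglyMeasurable (Measurable.mul (by fun_prop) (hh.comp measurable_snd))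

open scoped FourierTransform in
lemma FT_eq_fourier (d : ℕ) (f : SchwartzMap (Ed d) ℂ) (ξ : Ed d) :
    FT d (fun x => f x) ξ = (𝓕 f : SchwartzMap (Ed d) ℂ) ((2 * Real.pi)⁻¹ • ξ) := by
  rw [SchwartzMap.fourier_coe, Real.fourier_eq', FT]
  refine integral_congr_ae (Eventually.of_forall fun x => ?_)
  simp only [smul_eq_mul, real_inner_smul_right]
  congr 2
  have : (Real.pi : ℂ) ≠ 0 := by exact_mod_cast Real.pi_ne_zero
  push_cast
  field_simp

open scoped FourierTransform in
lemma exists_pow_mul_norm_FT_le (d : ℕ) (f : SchwartzMap (Ed d) ℂ) (k : ℕ) :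
    ∃ C : ℝ, 0 < C ∧ ∀ ξ : Ed d, ‖ξ‖ ^ k * ‖FT d (fun x => f x) ξ‖ ≤ C := by
  obtain ⟨C, hC, hb⟩ := (𝓕 f : SchwartzMap (Ed d) ℂ).decay k 0
  refine ⟨(2 * Real.pi) ^ k * C, by positivity, fun ξ => ?_⟩
  have h := hb ((2 * Real.pi)⁻¹ • ξ)
  rw [norm_iteratedFDeriv_zero, ← FT_eq_fourier, norm_smul, mul_pow,
    Real.norm_of_nonneg (by positivity)] at h
  calc ‖ξ‖ ^ k * ‖FT d (fun x => f x) ξ‖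
      = (2 * Real.pi) ^ k * ((2 * Real.pi)⁻¹ ^ k * ‖ξ‖ ^ k * ‖FT d (fun x => f x) ξ‖) := by
        rw [inv_pow]; field_simp
    _ ≤ _ := by gcongr

lemma integrable_rpow_norm_mul_FT (d : ℕ) (hd : 1 ≤ d) {s : ℝ} (hs : -(d : ℝ) < s)
    (f : SchwartzMap (Ed d) ℂ) :
    Integrable fun ξ : Ed d => ((‖ξ‖ ^ s : ℝ) : ℂ) * FT d (fun x => f x) ξ := by
  obtain ⟨k, hk⟩ := exists_nat_gt (s + d)
  obtain ⟨C₀, hC₀, h₀⟩ := exists_pow_mul_norm_FT_le d f 0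
  obtain ⟨C₁, hC₁, h₁⟩ := exists_pow_mul_norm_FT_le d f k
  have : Nonempty (Fin d) := ⟨⟨0, hd⟩⟩
  have hpow : ∀ y : ℝ, 0 < y → ∀ u : ℝ, y ^ (d - 1) * y ^ u = y ^ ((d : ℝ) - 1 + u) := by
    intro y hy u
    rw [Real.rpow_add hy, ← Real.rpow_natCast, Nat.cast_sub hd, Nat.cast_one]
  set φ : ℝ → ℝ := fun y => if y ≤ 1 then C₀ * y ^ s else C₁ * y ^ (s - k) with hφ
  have hφi : Integrable fun ξ : Ed d => φ ‖ξ‖ := by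
    rw [integrable_fun_norm_addHaar, finrank_euclideanSpace, Fintype.card_fin,
      ← Set.Ioc_union_Ioi_eq_Ioi zero_le_one]
    refine IntegrableOn.union ?_ ?_
    · have : IntegrableOn (fun y : ℝ => C₀ * y ^ ((d : ℝ) - 1 + s)) (Set.Ioc 0 1) :=
        ((intervalIntegrable_iff_integrableOn_Ioc_of_le zero_le_one).1
          (intervalIntegral.intervalIntegrable_rpow' (by linarith))).const_mul _
      refine this.congr_fun (fun y hy => ?_) measurableSet_Ioc
      simp only [hφ, if_pos hy.2, smul_eq_mul]
      rw [← hpow y hy.1]; ring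
    · have : IntegrableOn (fun y : ℝ => C₁ * y ^ ((d : ℝ) - 1 + (s - k))) (Set.Ioi 1) :=
        (integrableOn_Ioi_rpow_of_lt (by linarith) one_pos).const_mul _
      refine this.congr_fun (fun y (hy : 1 < y) => ?_) measurableSet_Ioi
      simp only [hφ, if_neg (not_le.2 hy), smul_eq_mul]
      rw [← hpow y (by linarith)]; ring
  refine hφi.mono' ?_ (Eventually.of_forall fun ξ => ?_)
  · exact (Measurable.mul (by fun_prop)
      (measurable_FT d f.continuous.measurable)).aestronglyMeasurable
  · rw [norm_mul, norm_real, Real.norm_of_nonneg (by positivity)]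
    by_cases h : ‖ξ‖ ≤ 1
    · simp only [hφ, if_pos h]
      rw [mul_comm C₀]
      gcongr
      simpa using h₀ ξ
    · simp only [hφ, if_neg h]
      have hn : 0 < ‖ξ‖ := by linarith
      rw [Real.rpow_sub hn, Real.rpow_natCast, mul_div_left_comm]
      gcongr
      rw [le_div_iff₀ (by positivity), mul_comm]
      exact h₁ ξ

lemma eLpNorm_eq_lintegral_ofReal_norm_rpow {X : Type*} [MeasurableSpace X] (μ : Measure X)
    {r : ℝ≥0∞} (h0 : r ≠ 0) (htop : r ≠ ∞) (u : X → ℂ) :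
    eLpNorm u r μ = (∫⁻ x, ENNReal.ofReal (‖u x‖ ^ r.toReal) ∂μ) ^ (1 / r.toReal) := by
  rw [eLpNorm_eq_lintegral_rpow_enorm_toReal h0 htop]
  congr 1
  refine lintegral_congr fun x => ?_
  rw [← ofReal_norm, ENNReal.ofReal_rpow_of_nonneg (norm_nonneg _) ENNReal.toReal_nonneg]

lemma kernelPotential_const_mul {X : Type*} [MeasurableSpace X] (μ : Measure X)
    (K : ℝ → X → X → ℝ≥0∞) (a : ℝ) (S : Set ℝ) (g : X → ℝ≥0∞) {c : ℝ≥0∞} (hc : c ≠ ∞) (x : X) :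
    kernelPotential μ K a S (fun y => c * g y) x = c * kernelPotential μ K a S g x := by
  unfold kernelPotential
  rw [← lintegral_const_mul' _ _ hc]
  refine lintegral_congr fun t => ?_
  simp_rw [mul_left_comm _ c]
  rw [lintegral_const_mul' _ _ hc, mul_left_comm]

/-- `|D|^s f` is pointwise dominated by the heat kernel potential of `|D|^{s₁} f`. -/
lemma enorm_rieszD_le_kernelPotential (d : ℕ) (hd : 1 ≤ d) {s s₁ : ℝ} (hs : -(d : ℝ) < s)
    (hlt : s < s₁) (f : SchwartzMap (Ed d) ℂ) (x : Ed d) :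
    ENNReal.ofReal (Real.Gamma ((s₁ - s) / 2)) * ‖rieszD d s (fun x => f x) x‖ₑ ≤
      kernelPotential volume (fun t x y => ENNReal.ofReal (heatKernel d t x y)) ((s₁ - s) / 2)
        (Set.Ioi 0) (fun y => ‖rieszD d s₁ (fun x => f x) y‖ₑ) x := by
  have : Nonempty (Fin d) := ⟨⟨0, hd⟩⟩
  have hne : ∀ᵐ ξ : Ed d, ξ ≠ 0 := by simp [ae_iff]
  have ha : 0 < (s₁ - s) / 2 := by linarith
  set a : ℝ := (s₁ - s) / 2 with haeq
  set h : Ed d → ℂ := fun ξ => ((‖ξ‖ ^ s₁ : ℝ) : ℂ) * FT d (fun x => f x) ξ with hh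
  have hFT : Measurable (FT d fun x => f x) := measurable_FT d f.continuous.measurable
  have hm : Measurable h := Measurable.mul (by fun_prop) hFT
  have hi : Integrable h := integrable_rpow_norm_mul_FT d hd (hs.trans hlt) f
  have hae : (fun ξ : Ed d => ((‖ξ‖ ^ s : ℝ) : ℂ) * FT d (fun x => f x) ξ) =ᵐ[volume]
      fun ξ => ((‖ξ‖ ^ (-(2 * a)) : ℝ) : ℂ) * h ξ := by
    filter_upwards [hne] with ξ hξ
    rw [hh, ← mul_assoc, ← ofReal_mul, ← Real.rpow_add (norm_pos_iff.2 hξ)]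
    congr 4
    rw [haeq]; ring
  have hi' : Integrable fun ξ : Ed d => ((‖ξ‖ ^ (-(2 * a)) : ℝ) : ℂ) * h ξ :=
    (integrable_rpow_norm_mul_FT d hd hs f).congr hae
  have hF : rieszD d s (fun x => f x) x =
      FTinv d (fun ξ => ((‖ξ‖ ^ (-(2 * a)) : ℝ) : ℂ) * h ξ) x := by
    unfold rieszD FTinv
    congr 1
    refine integral_congr_ae ?_
    filter_upwards [hae] with ξ hξ
    rw [hξ]
  rw [hF]
  refine (enorm_FTinv_rpow_mul_le d hd ha hm hi' x).trans ?_
  refine setLIntegral_mono' measurableSet_Ioi fun t (ht : 0 < t) => ?_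
  gcongr
  rw [FTinv_exp_mul d ht hi]
  refine (enorm_integral_le_lintegral_enorm _).trans_eq (lintegral_congr fun y => ?_)
  rw [enorm_mul, ← ofReal_norm ((heatKernel d t x y : ℝ) : ℂ), norm_real,
    Real.norm_of_nonneg (heatKernel_nonneg d ht x y)]
  rfl

/-- Homogeneous Sobolev embedding. For `d ≥ 1`, `s ≤ s₁`, `s > -d` and
`1 < r₁ ≤ r < ∞` with `s - d/r = s₁ - d/r₁`, there is `C > 0` such that every Schwartz `f`
satisfies `‖f‖_{Ẇ^{s,r}} ≤ C ‖f‖_{Ẇ^{s₁,r₁}}`. -/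
theorem homogeneous_sobolev_embedding
    (d : ℕ) (hd : 1 ≤ d) (s s₁ : ℝ) (hss₁ : s ≤ s₁) (hs : -(d : ℝ) < s)
    (r r₁ : ℝ≥0∞) (hr₁ : 1 < r₁) (hr₁r : r₁ ≤ r) (hr : r < ∞)
    (hscal : s - d * (1 / r).toReal = s₁ - d * (1 / r₁).toReal) :
    ∃ C : ℝ, 0 < C ∧
      ∀ f : SchwartzMap (Ed d) ℂ,
        sobNorm d s r (fun x => f x) ≤ ENNReal.ofReal C * sobNorm d s₁ r₁ (fun x => f x) := by
  have hr₁0 : r₁ ≠ 0 := (zero_lt_one.trans hr₁).ne'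
  have hr₁t : r₁ ≠ ∞ := (hr₁r.trans_lt hr).ne
  have hr0 : r ≠ 0 := (zero_lt_one.trans (hr₁.trans_le hr₁r)).ne'
  have hp : 1 < r₁.toReal := by
    simpa using (ENNReal.toReal_lt_toReal ENNReal.one_ne_top hr₁t).2 hr₁
  have hq : 0 < r.toReal := ENNReal.toReal_pos hr0 hr.ne
  have hd0 : (0 : ℝ) < d := by exact_mod_cast hd
  simp only [one_div, ENNReal.toReal_inv] at hscal
  rcases hss₁.eq_or_lt with rfl | hlt
  · have hinv : r.toReal = r₁.toReal := by
      have : (d : ℝ) * r.toReal⁻¹ = d * r₁.toReal⁻¹ := by linarith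
      exact inv_injective (mul_left_cancel₀ hd0.ne' this)
    have hrr : r = r₁ := (ENNReal.toReal_eq_toReal_iff' hr.ne hr₁t).1 hinv
    exact ⟨1, one_pos, fun f => by simp [hrr]⟩
  have ha : 0 < (s₁ - s) / 2 := by linarith
  set a : ℝ := (s₁ - s) / 2 with haeq
  have hΓ := Real.Gamma_pos_of_pos ha
  have hb : 0 < (d : ℝ) / 2 / r.toReal := by positivity
  have hab : (d : ℝ) / 2 / r₁.toReal = a + (d : ℝ) / 2 / r.toReal := by
    rw [div_eq_mul_inv _ r₁.toReal, div_eq_mul_inv _ r.toReal, haeq]; linarith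
  have hrm : r.toReal = (d : ℝ) / 2 / ((d : ℝ) / 2 / r.toReal) := by field_simp
  set K : ℝ → Ed d → Ed d → ℝ≥0∞ := fun t x y => ENNReal.ofReal (heatKernel d t x y) with hKdef
  have hK : Measurable fun z : ℝ × Ed d × Ed d => K z.1 z.2.1 z.2.2 :=
    (measurable_heatKernel d).ennreal_ofReal
  obtain ⟨C, hC, hmain⟩ := lintegral_rpow_le_of_le_kernelPotential (μ := volume) (K := K)
    (fun t ht x => (lintegral_heatKernel d ht x).le)
    (fun t ht y => by
      simp only [hKdef, heatKernel_symm d t _ y]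
      exact (lintegral_heatKernel d ht y).le) hK
    (B := (4 * Real.pi) ^ (-((d : ℝ) / 2))) (m := (d : ℝ) / 2) (by positivity)
    (fun t ht x y => ENNReal.ofReal_le_ofReal (heatKernel_le d ht x y)) hp ha hb hab hrm
  refine ⟨C ^ (1 / r.toReal) / Real.Gamma a, by positivity, fun f => ?_⟩
  unfold sobNorm
  have hmeas : ∀ σ : ℝ, Measurable (rieszD d σ fun x => f x) := fun σ =>
    measurable_FTinv d (Measurable.mul (by fun_prop) (measurable_FT d f.continuous.measurable))
  set F := rieszD d s fun x => f x with hF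
  set g := rieszD d s₁ fun x => f x with hg
  have hpt : ∀ x, ENNReal.ofReal (Real.Gamma a) * ‖F x‖ₑ ≤
      kernelPotential volume K a (Set.Ioi 0) (fun y => ‖g y‖ₑ) x := fun x =>
    enorm_rieszD_le_kernelPotential d hd hs hlt f x
  by_cases htop : eLpNorm g r₁ volume = ∞
  · rw [htop, ENNReal.mul_top (by simpa using by positivity)]
    exact le_top
  by_cases hzero : eLpNorm g r₁ volume = 0
  · have hg0 : g =ᵐ[volume] 0 := (eLpNorm_eq_zero_iff (hmeas s₁).aestronglyMeasurable hr₁0).1 hzero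
    have hF0 : F = 0 := by
      ext x
      have hT : kernelPotential volume K a (Set.Ioi 0) (fun y => ‖g y‖ₑ) x = 0 := by
        unfold kernelPotential
        have : ∀ t, ∫⁻ y, K t x y * ‖g y‖ₑ = 0 := fun t => by
          rw [lintegral_congr_ae (g := fun _ => 0), lintegral_zero]
          filter_upwards [hg0] with y hy
          simp [hy]
        simp [this]
      have h0 := hpt x
      rw [hT, nonpos_iff_eq_zero, mul_eq_zero] at h0
      simpa [hΓ.not_ge] using h0
    simp [hF0]
  set n : ℝ := (eLpNorm g r₁ volume).toReal with hn
  have hn0 : 0 < n := ENNReal.toReal_pos hzero htop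
  have hN : eLpNorm g r₁ volume = ENNReal.ofReal n := (ENNReal.ofReal_toReal htop).symm
  have hscale : ∀ {c : ℝ}, 0 ≤ c → ∀ (u : Ed d → ℂ) (σ : ℝ≥0∞), σ ≠ 0 → σ ≠ ∞ →
      (∫⁻ x, ENNReal.ofReal ((c * ‖u x‖) ^ σ.toReal)) ^ (1 / σ.toReal) =
        ENNReal.ofReal c * eLpNorm u σ volume := by
    intro c hc u σ h0 ht
    have := eLpNorm_eq_lintegral_ofReal_norm_rpow volume h0 ht (c • u)
    rw [eLpNorm_const_smul] at this
    simp only [Pi.smul_apply, norm_smul, Real.norm_of_nonneg hc] at this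
    rw [← this, ← ofReal_norm, Real.norm_of_nonneg hc]
  have hres := hmain (fun x => Real.Gamma a / n * ‖F x‖) (fun y => n⁻¹ * ‖g y‖)
    (((hmeas s).norm.const_mul _).aemeasurable) ((hmeas s₁).norm.const_mul _)
    (fun x => by positivity) (fun y => by positivity) ?_ ?_
  · have h1 := ENNReal.rpow_le_rpow hres (z := 1 / r.toReal) (by positivity)
    rw [hscale (by positivity) F r hr0 hr.ne,
      ENNReal.ofReal_rpow_of_nonneg hC.le (by positivity)] at h1
    calc eLpNorm F r volume
        = ENNReal.ofReal (n / Real.Gamma a) *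
            (ENNReal.ofReal (Real.Gamma a / n) * eLpNorm F r volume) := by
          rw [← mul_assoc, ← ENNReal.ofReal_mul (by positivity),
            div_mul_div_cancel₀ hΓ.ne', div_self hn0.ne', ENNReal.ofReal_one, one_mul]
      _ ≤ ENNReal.ofReal (n / Real.Gamma a) * ENNReal.ofReal (C ^ (1 / r.toReal)) := by gcongr
      _ = ENNReal.ofReal (C ^ (1 / r.toReal) / Real.Gamma a) * eLpNorm g r₁ volume := by
          rw [hN, ← ENNReal.ofReal_mul (by positivity), ← ENNReal.ofReal_mul (by positivity)]
          congr 1; ring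
  · have h1 := hscale (inv_nonneg.2 hn0.le) g r₁ hr₁0 hr₁t
    rw [hN, ← ENNReal.ofReal_mul (by positivity), inv_mul_cancel₀ hn0.ne', ENNReal.ofReal_one] at h1
    rw [← ENNReal.rpow_le_rpow_iff (z := 1 / r₁.toReal) (by positivity), h1, ENNReal.one_rpow]
  · intro x
    have hfun : (fun y => ENNReal.ofReal (n⁻¹ * ‖g y‖)) =
        fun y => ENNReal.ofReal n⁻¹ * ‖g y‖ₑ := by
      ext y
      rw [ENNReal.ofReal_mul (by positivity), ofReal_norm]
    rw [hfun, kernelPotential_const_mul _ _ _ _ _ ENNReal.ofReal_ne_top]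
    calc ENNReal.ofReal (Real.Gamma a / n * ‖F x‖)
        = ENNReal.ofReal n⁻¹ * (ENNReal.ofReal (Real.Gamma a) * ‖F x‖ₑ) := by
          rw [← ofReal_norm (F x), ← ENNReal.ofReal_mul (by positivity),
            ← ENNReal.ofReal_mul (by positivity)]
          congr 1; ring
      _ ≤ _ := by gcongr; exact hpt x
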